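/- Let (b,0) (edge weight b, potential identically zero) be a transient connected graph over a countably infinite set X, and suppose there exists a non-constant harmonic function of finite energy on X. Then there exists a non-constant bounded harmonic function on X. -/

import Mathlib

open ENNReal Filter Topology

namespace UTGraph

variable {X : Type*}

/-- A graph over `X`: symmetric nonnegative edge weight `b` with zero diagonal and
summable rows, together with a nonnegative potential (killing term) `c`. -/
structure IsGraph (b : X → X → ℝ) (c : X → ℝ) : Prop where
  symm : ∀ x y, b x y = b y x
  nonneg : ∀ x y, 0 ≤ b x y
  loopless : ∀ x, b x x = 0
  row_summable : ∀ x, Summable fun y => b x y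
  c_nonneg : ∀ x, 0 ≤ c x

/-- Connectedness: any two vertices are joined by a path of positive edge weights. -/
def Connected (b : X → X → ℝ) : Prop :=
  ∀ x y : X, Relation.ReflTransGen (fun u v => 0 < b u v) x y

/-- The energy form `Q(f)`, with values in `[0,∞]`. -/
noncomputable def energy (b : X → X → ℝ) (c : X → ℝ) (f : X → ℝ) : ℝ≥0∞ :=
  (1 / 2) * ∑' p : X × X, ENNReal.ofReal (b p.1 p.2 * (f p.1 - f p.2) ^ 2)
    + ∑' x, ENNReal.ofReal (c x * f x ^ 2)

/-- `f` has finite energy, i.e. `f ∈ D`. -/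
def FiniteEnergy (b : X → X → ℝ) (c : X → ℝ) (f : X → ℝ) : Prop :=
  energy b c f < ⊤

/-- The bilinear energy form `Q(f,g)` (for finite-energy functions). -/
noncomputable def energyBilin (b : X → X → ℝ) (c : X → ℝ) (f g : X → ℝ) : ℝ :=
  (1 / 2) * ∑' p : X × X, b p.1 p.2 * (f p.1 - f p.2) * (g p.1 - g p.2)
    + ∑' x, c x * f x * g x

/-- `f ∈ C_c(X)`: finitely supported function. -/
def FinSupp (f : X → ℝ) : Prop := (Function.support f).Finite

/-- The norm `‖f‖_o = (Q(f) + f(o)²)^{1/2}`. -/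
noncomputable def normO (b : X → X → ℝ) (c : X → ℝ) (o : X) (f : X → ℝ) : ℝ :=
  Real.sqrt ((energy b c f).toReal + f o ^ 2)

/-- `f ∈ D₀`: there is a sequence of finitely supported functions converging to `f`
pointwise whose energy difference to `f` tends to `0`. -/
def MemD0 (b : X → X → ℝ) (c : X → ℝ) (f : X → ℝ) : Prop :=
  ∃ φ : ℕ → X → ℝ, (∀ n, FinSupp (φ n)) ∧
    (∀ x, Tendsto (fun n => φ n x) atTop (𝓝 (f x))) ∧
    Tendsto (fun n => energy b c (φ n - f)) atTop (𝓝 0)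

/-- `f ∈ C₀(X)`: `f` belongs to the uniform closure of the finitely supported functions,
i.e. for every `ε > 0` the set where `|f| ≥ ε` is finite. -/
def MemC0 (f : X → ℝ) : Prop := ∀ ε : ℝ, 0 < ε → {x | ε ≤ |f x|}.Finite

/-- The graph is uniformly transient: `D₀ ⊆ C₀(X)`. -/
def UniformlyTransient (b : X → X → ℝ) (c : X → ℝ) : Prop :=
  ∀ f : X → ℝ, MemD0 b c f → MemC0 f

/-- The capacity of a point: `cap(x) = inf {Q(φ) : φ ∈ C_c(X), φ(x) = 1}`. -/
noncomputable def cap (b : X → X → ℝ) (c : X → ℝ) (x : X) : ℝ≥0∞ :=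
  ⨅ (φ : X → ℝ) (_ : FinSupp φ) (_ : φ x = 1), energy b c φ

/-- `f ∈ F`: the domain of the formal Laplacian. -/
def MemF (b : X → X → ℝ) (f : X → ℝ) : Prop :=
  ∀ x, Summable fun y => b x y * |f y|

/-- The formal Laplacian `𝓛 f (x) = Σ_y b(x,y)(f(x) - f(y)) + c(x) f(x)`. -/
noncomputable def formalLaplacian (b : X → X → ℝ) (c : X → ℝ) (f : X → ℝ) (x : X) : ℝ :=
  (∑' y, b x y * (f x - f y)) + c x * f x

/-- `f` is harmonic: `f ∈ F` and `𝓛 f = 0`. -/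
def Harmonic (b : X → X → ℝ) (c : X → ℝ) (f : X → ℝ) : Prop :=
  MemF b f ∧ ∀ x, formalLaplacian b c f x = 0

/-- The graph is recurrent: the constant function `1` lies in `D₀` and `Q(1) = 0`. -/
def Recurrent (b : X → X → ℝ) (c : X → ℝ) : Prop :=
  MemD0 b c 1 ∧ energy b c 1 = 0

/-- The graph is transient: not recurrent. -/
def Transient (b : X → X → ℝ) (c : X → ℝ) : Prop := ¬ Recurrent b c

/-- The metric `γ_o`. -/
noncomputable def gammaO (b : X → X → ℝ) (c : X → ℝ) (o x y : X) : ℝ :=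
  sSup {d : ℝ | ∃ φ : X → ℝ, FinSupp φ ∧
    energy b c φ + ENNReal.ofReal (φ o ^ 2) ≤ 1 ∧ d = |φ x - φ y|}

/-- The metric `γ`. -/
noncomputable def gamma (b : X → X → ℝ) (c : X → ℝ) (x y : X) : ℝ :=
  sSup {d : ℝ | ∃ φ : X → ℝ, FinSupp φ ∧ energy b c φ ≤ 1 ∧ d = |φ x - φ y|}

/-- `d` is a metric on `X`. -/
def IsMetric (d : X → X → ℝ) : Prop :=
  (∀ x y, 0 ≤ d x y) ∧ (∀ x y, d x y = d y x) ∧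
  (∀ x y, d x y = 0 ↔ x = y) ∧ (∀ x y z, d x z ≤ d x y + d y z)

/-- `f` belongs to the closure of `C_c(X)` with respect to the norm
`‖·‖_Q = (Q(·) + ‖·‖_m²)^{1/2}` inside `D ∩ ℓ²(X,m)`. -/
def MemFormDomain (b : X → X → ℝ) (c : X → ℝ) (m : X → ℝ) (f : X → ℝ) : Prop :=
  FiniteEnergy b c f ∧ Summable (fun x => m x * f x ^ 2) ∧
  ∃ φ : ℕ → X → ℝ, (∀ n, FinSupp (φ n)) ∧
    Tendsto (fun n => energy b c (f - φ n)
      + ∑' x, ENNReal.ofReal (m x * (f x - φ n x) ^ 2)) atTop (𝓝 0)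

variable {b : X → X → ℝ}

/-- Twice the energy of `w` with zero potential. -/
noncomputable def edgeEnergy (b : X → X → ℝ) (w : X → ℝ) : ℝ≥0∞ :=
  ∑' p : X × X, ENNReal.ofReal (b p.1 p.2 * (w p.1 - w p.2) ^ 2)

theorem edgeEnergy_ne_top {f : X → ℝ} (hf : FiniteEnergy b (fun _ => 0) f) :
    edgeEnergy b f ≠ ⊤ := by
  intro h
  unfold edgeEnergy at h
  simp [FiniteEnergy, energy, h, ENNReal.mul_top] at hf

theorem lowerSemicontinuous_edgeEnergy_sub (b : X → X → ℝ) (f : X → ℝ) :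
    LowerSemicontinuous fun h : X → ℝ => edgeEnergy b (h - f) := by
  unfold edgeEnergy
  refine lowerSemicontinuous_tsum fun p => Continuous.lowerSemicontinuous ?_
  refine ENNReal.continuous_ofReal.comp ?_
  simp only [Pi.sub_apply]
  fun_prop

/-- In a connected graph every non-constant function varies along some edge. -/
theorem Connected.exists_edge_ne (hconn : Connected b) {f : X → ℝ}
    (hf : ¬ ∃ k : ℝ, ∀ x, f x = k) : ∃ x y, 0 < b x y ∧ f x ≠ f y := by
  by_contra! hedge
  have hconst : ∀ x y, f x = f y := fun x y => by
    induction hconn x y with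
    | refl => rfl
    | tail _ huv ih => exact ih.trans (hedge _ _ huv)
  rcases isEmpty_or_nonempty X with hX | ⟨⟨o⟩⟩
  · exact hf ⟨0, fun x => isEmptyElim x⟩
  · exact hf ⟨f o, fun x => hconst x o⟩

/-- The part of a function cut off by truncation varies less than the function itself. -/
theorem sq_trunc_sub_le (n s t : ℝ) :
    ((max (-n) (min s n) - s) - (max (-n) (min t n) - t)) ^ 2 ≤ (s - t) ^ 2 := by
  rw [sq_le_sq, abs_le]
  rcases le_total s t with h | h
  · rw [abs_of_nonpos (sub_nonpos.2 h)]
    constructor <;> rcases max_cases (-n) (min s n) with h1 | h1 <;>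
      rcases max_cases (-n) (min t n) with h2 | h2 <;>
      rcases min_cases s n with h3 | h3 <;> rcases min_cases t n with h4 | h4 <;> linarith
  · rw [abs_of_nonneg (sub_nonneg.2 h)]
    constructor <;> rcases max_cases (-n) (min s n) with h1 | h1 <;>
      rcases max_cases (-n) (min t n) with h2 | h2 <;>
      rcases min_cases s n with h3 | h3 <;> rcases min_cases t n with h4 | h4 <;> linarith

/-- A non-constant function of finite energy is strictly closer in energy to some truncation
of itself than to the constants. -/
theorem exists_trunc_edgeEnergy_lt (hb : ∀ x y, 0 ≤ b x y) (hconn : Connected b) {f : X → ℝ}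
    (hfin : edgeEnergy b f ≠ ⊤) (hf : ¬ ∃ k : ℝ, ∀ x, f x = k) :
    ∃ n : ℝ, 0 ≤ n ∧
      edgeEnergy b ((fun x => max (-n) (min (f x) n)) - f) < edgeEnergy b f := by
  obtain ⟨x, y, hxy, hne⟩ := hconn.exists_edge_ne hf
  set n := max |f x| |f y|
  have htrunc : ∀ z, |f z| ≤ n → max (-n) (min (f z) n) = f z := fun z hz => by
    rw [min_eq_left (abs_le.1 hz).2, max_eq_right (abs_le.1 hz).1]
  have hle : ∀ p : X × X,
      ENNReal.ofReal (b p.1 p.2 * (((fun x => max (-n) (min (f x) n)) - f) p.1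
        - ((fun x => max (-n) (min (f x) n)) - f) p.2) ^ 2)
      ≤ ENNReal.ofReal (b p.1 p.2 * (f p.1 - f p.2) ^ 2) := fun p =>
    ENNReal.ofReal_le_ofReal
      (mul_le_mul_of_nonneg_left (sq_trunc_sub_le n (f p.1) (f p.2)) (hb _ _))
  refine ⟨n, (abs_nonneg _).trans (le_max_left _ _), ?_⟩
  refine ENNReal.tsum_lt_tsum (i := (x, y)) ?_ hle ?_
  · exact ne_top_of_le_ne_top hfin (ENNReal.tsum_le_tsum hle)
  · simp only [Pi.sub_apply]
    rw [htrunc x (le_max_left _ _), htrunc y (le_max_right _ _)]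
    have : 0 < b x y * (f x - f y) ^ 2 :=
      mul_pos hxy (sq_pos_of_ne_zero (sub_ne_zero.2 hne))
    simpa using this

/-- The change of edge energy under a perturbation at a single vertex. -/
theorem hasSum_edge_perturb [DecidableEq X] (hg : IsGraph b (fun _ => 0)) {w : X → ℝ} {x : X}
    (hw : Summable fun y => b x y * (w x - w y)) (t : ℝ) :
    HasSum (fun p : X × X =>
        b p.1 p.2 * (Function.update w x (w x + t) p.1
          - Function.update w x (w x + t) p.2) ^ 2
        - b p.1 p.2 * (w p.1 - w p.2) ^ 2)
      (2 * (t * (2 * (∑' y, b x y * (w x - w y)) + t * ∑' y, b x y))) := by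
  set r : X × X → ℝ := fun p =>
    if p.1 = x then t * (2 * (b x p.2 * (w x - w p.2)) + t * b x p.2) else 0 with hr
  have hrow : HasSum r (t * (2 * (∑' y, b x y * (w x - w y)) + t * ∑' y, b x y)) := by
    have hinj : Function.Injective fun y : X => (x, y) := Prod.mk_right_injective x
    rw [← hinj.hasSum_iff]
    · have := ((hw.hasSum.mul_left 2).add ((hg.row_summable x).hasSum.mul_left t)).mul_left t
      simpa [hr, Function.comp_def] using this
    · rintro ⟨u, v⟩ huv
      have : u ≠ x := by
        rintro rfl
        exact huv ⟨v, rfl⟩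
      simp [hr, this]
  have hcol : HasSum (fun p : X × X => r p.swap)
      (t * (2 * (∑' y, b x y * (w x - w y)) + t * ∑' y, b x y)) :=
    (Equiv.prodComm X X).hasSum_iff.2 hrow
  rw [two_mul]
  convert hrow.add hcol using 2 with p
  obtain ⟨u, v⟩ := p
  by_cases hu : u = x <;> by_cases hv : v = x
  · simp [hr, hu, hv, hg.loopless]
  · subst hu
    simp [hr, hv]
    ring
  · subst hv
    simp [hr, hu, hg.symm u v]
    ring
  · simp [hr, hu, hv]

/-- If the edge energy of `h - f` cannot be lowered by values in `[-n, n]` at `x`, where `h`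
takes values in `[-n, n]` and `f` is harmonic, then `h` is harmonic at `x`. -/
theorem laplacian_eq_zero_of_isMinOn (hg : IsGraph b (fun _ => 0)) {f h : X → ℝ} {n : ℝ}
    (hf : Harmonic b (fun _ => 0) f) (hh : h ∈ Set.univ.pi fun _ : X => Set.Icc (-n) n)
    (hfin : edgeEnergy b (h - f) ≠ ⊤)
    (hmin : IsMinOn (fun g => edgeEnergy b (g - f))
      (Set.univ.pi fun _ : X => Set.Icc (-n) n) h) (x : X) :
    ∑' y, b x y * (h x - h y) = 0 := by
  classical
  have hb := hg.nonneg
  have hbh : Summable fun y => b x y * h y :=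
    Summable.of_norm_bounded ((hg.row_summable x).mul_right n) fun y => by
      rw [Real.norm_eq_abs, abs_mul, abs_of_nonneg (hb x y)]
      exact mul_le_mul_of_nonneg_left (abs_le.2 (hh y trivial)) (hb x y)
  have hbf : Summable fun y => b x y * f y :=
    Summable.of_norm_bounded (hf.1 x) fun y => by
      rw [Real.norm_eq_abs, abs_mul, abs_of_nonneg (hb x y)]
  have hLh : Summable fun y => b x y * (h x - h y) := by
    simpa only [mul_sub] using ((hg.row_summable x).mul_right (h x)).sub hbh
  have hLf : Summable fun y => b x y * (f x - f y) := by
    simpa only [mul_sub] using ((hg.row_summable x).mul_right (f x)).sub hbf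
  have hsplit : ∀ y, b x y * ((h - f) x - (h - f) y)
      = b x y * (h x - h y) - b x y * (f x - f y) := fun y => by
    simp only [Pi.sub_apply]
    ring
  have hLw : Summable fun y => b x y * ((h - f) x - (h - f) y) := by
    simpa only [hsplit] using hLh.sub hLf
  have hLw_eq : ∑' y, b x y * ((h - f) x - (h - f) y) = ∑' y, b x y * (h x - h y) := by
    have hfx : ∑' y, b x y * (f x - f y) = 0 := by simpa [formalLaplacian] using hf.2 x
    rw [tsum_congr hsplit, hLh.tsum_sub hLf, hfx, sub_zero]
  have hL_eq : ∑' y, b x y * (h x - h y) = (∑' y, b x y) * h x - ∑' y, b x y * h y := by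
    simp only [mul_sub]
    rw [((hg.row_summable x).mul_right (h x)).tsum_sub hbh, tsum_mul_right]
  rcases (tsum_nonneg (hb x)).eq_or_lt with hdeg | hdeg
  · have hzero : ∀ y, b x y = 0 := fun y =>
      congrFun ((hasSum_zero_iff_of_nonneg (hb x)).1 (hdeg ▸ (hg.row_summable x).hasSum)) y
    simp [hzero]
  set d := ∑' y, b x y with hd
  set L := ∑' y, b x y * (h x - h y)
  have hupper : ∑' y, b x y * h y ≤ d * n := by
    rw [hd, ← tsum_mul_right]
    exact hbh.tsum_le_tsum (fun y => mul_le_mul_of_nonneg_left (hh y trivial).2 (hb x y))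
      ((hg.row_summable x).mul_right n)
  have hlower : d * -n ≤ ∑' y, b x y * h y := by
    rw [hd, ← tsum_mul_right]
    exact ((hg.row_summable x).mul_right (-n)).tsum_le_tsum
      (fun y => mul_le_mul_of_nonneg_left (hh y trivial).1 (hb x y)) hbh
  have hmean : h x + -L / d = (∑' y, b x y * h y) / d := by
    rw [hL_eq]
    field_simp
    ring
  have hmem : Function.update h x (h x + -L / d) ∈ Set.univ.pi fun _ : X => Set.Icc (-n) n := by
    intro y _
    rcases eq_or_ne y x with rfl | hy
    · rw [Function.update_self, hmean]
      exact ⟨(le_div_iff₀ hdeg).2 (by linarith), (div_le_iff₀ hdeg).2 (by linarith)⟩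
    · rw [Function.update_of_ne hy]
      exact hh y trivial
  have hupd : Function.update h x (h x + -L / d) - f
      = Function.update (h - f) x ((h - f) x + -L / d) := by
    ext y
    rcases eq_or_ne y x with rfl | hy
    · simp
      ring
    · simp [hy]
  have hle : edgeEnergy b (h - f)
      ≤ edgeEnergy b (Function.update (h - f) x ((h - f) x + -L / d)) := hupd ▸ hmin hmem
  have hnonneg : ∀ (w : X → ℝ) (p : X × X), 0 ≤ b p.1 p.2 * (w p.1 - w p.2) ^ 2 :=
    fun w p => mul_nonneg (hb _ _) (sq_nonneg _)
  have hsum : Summable fun p : X × X => b p.1 p.2 * ((h - f) p.1 - (h - f) p.2) ^ 2 :=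
    (ENNReal.summable_toReal hfin).congr fun p => ENNReal.toReal_ofReal (hnonneg _ p)
  have hpert := hsum.hasSum.add (hasSum_edge_perturb hg hLw (-L / d))
  simp only [add_sub_cancel] at hpert
  unfold edgeEnergy at hle
  rw [← ENNReal.ofReal_tsum_of_nonneg (hnonneg _) hsum,
    ← ENNReal.ofReal_tsum_of_nonneg (hnonneg _) hpert.summable,
    ENNReal.ofReal_le_ofReal_iff (tsum_nonneg (hnonneg _)), hpert.tsum_eq, hLw_eq] at hle
  have hdrop : -L / d * (2 * L + -L / d * d) = -(L ^ 2 / d) := by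
    field_simp
    ring
  have hsq : L ^ 2 / d ≤ 0 := by linarith
  have : L ^ 2 ≤ 0 := by simpa using (div_le_iff₀ hdeg).1 hsq
  exact pow_eq_zero_iff two_ne_zero |>.1 (le_antisymm this (sq_nonneg L))

end UTGraph

open UTGraph Filter Topology ENNReal in
/-- on a transient connected graph `(b,0)`, the existence of a
non-constant harmonic function of finite energy implies the existence of a
non-constant bounded harmonic function. -/
theorem stmt19 {X : Type*} [Countable X] [Infinite X]
    (b : X → X → ℝ) (hgraph : IsGraph b (fun _ => 0))
    (hconn : Connected b) (htrans : Transient b (fun _ => 0))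
    (hex : ∃ f : X → ℝ, FiniteEnergy b (fun _ => 0) f ∧
      Harmonic b (fun _ => 0) f ∧ ¬ ∃ k : ℝ, ∀ x, f x = k) :
    ∃ g : X → ℝ, Harmonic b (fun _ => 0) g ∧ (∃ M : ℝ, ∀ x, |g x| ≤ M) ∧
      ¬ ∃ k : ℝ, ∀ x, g x = k := by
  obtain ⟨f, hfin, hharm, hne⟩ := hex
  have hfin' := edgeEnergy_ne_top hfin
  obtain ⟨n, hn, hlt⟩ := exists_trunc_edgeEnergy_lt hgraph.nonneg hconn hfin' hne
  have htrunc : (fun x => max (-n) (min (f x) n)) ∈ Set.univ.pi fun _ : X => Set.Icc (-n) n :=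
    fun x _ => ⟨le_max_left _ _, max_le (by linarith) (min_le_right _ _)⟩
  obtain ⟨h, hh, hmin⟩ :=
    ((lowerSemicontinuous_edgeEnergy_sub b f).lowerSemicontinuousOn _).exists_isMinOn
      ⟨_, htrunc⟩ (isCompact_univ_pi fun _ : X => isCompact_Icc (a := -n) (b := n))
  have hclose : edgeEnergy b (h - f) < edgeEnergy b f := (hmin htrunc).trans_lt hlt
  have hbdd : ∀ x, |h x| ≤ n := fun x => abs_le.2 (hh x trivial)
  refine ⟨h, ⟨fun x => ?_, fun x => ?_⟩, ⟨n, hbdd⟩, ?_⟩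
  · exact ((hgraph.row_summable x).mul_right n).of_nonneg_of_le
      (fun y => mul_nonneg (hgraph.nonneg x y) (abs_nonneg _))
      (fun y => mul_le_mul_of_nonneg_left (hbdd y) (hgraph.nonneg x y))
  · simpa [formalLaplacian] using
      laplacian_eq_zero_of_isMinOn hgraph hharm hh hclose.ne_top hmin x
  · rintro ⟨k, hk⟩
    refine hclose.ne (tsum_congr fun p => ?_)
    simp only [Pi.sub_apply, hk]
    ring_nf
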